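/- The set S is an independent set in G, and every vertex of G that does not lie in U is adjacent to at most one vertex of S. -/

import Mathlib

open SimpleGraph

/-- The set `U` of all vertices lying on some path of length `t` from `r` to a vertex of `S`. -/
def pathUnion {V : Type*} (G : SimpleGraph V) (t : ℕ) (r : V) (S : Set V) : Set V :=
  {v | ∃ s ∈ S, ∃ w : G.Walk r s, w.IsPath ∧ w.length = t ∧ v ∈ w.support}

/-- Two distinct paths with the same endpoints have total length at least the girth. -/
lemma SimpleGraph.Walk.IsPath.girth_le_length_add_length {V : Type*} {G : SimpleGraph V} {u v : V}
    {p q : G.Walk u v} (hp : p.IsPath) (hq : q.IsPath) (h : p ≠ q) :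
    G.girth ≤ p.length + q.length := by
  obtain ⟨_, _, _, c, hc, hle⟩ := hp.exists_isCycle_length_le_add_of_ne hq h
  exact (girth_le_length hc).trans hle

/-- `S` is an independent set, and every vertex outside `U` is adjacent to
at most one vertex of `S`. -/
theorem stmt7 {V : Type*} [Fintype V] (t d : ℕ) (ht : 0 < t) (hd : 0 < d)
    (G : SimpleGraph V) [DecidableRel G.Adj]
    (hreg : G.IsRegularOfDegree (d + 1)) (hgirth : (2 * t + 2 : ℕ∞) < G.girth)
    (r : V) (S : Set V) (hS : ∀ s ∈ S, G.dist r s = t)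
    (U : Set V) (hU : U = pathUnion G t r S) :
    (∀ a ∈ S, ∀ b ∈ S, ¬ G.Adj a b) ∧
    ∀ v ∉ U, {s ∈ S | G.Adj v s}.Subsingleton := by
  classical
  have hg : 2 * t + 2 < G.girth := by exact_mod_cast hgirth
  have hpath : ∀ s ∈ S, ∃ p : G.Walk r s, p.IsPath ∧ p.length = t := fun s hs ↦ by
    rw [← hS s hs] at ht ⊢
    exact (Reachable.of_dist_ne_zero ht.ne').exists_path_of_dist
  constructor
  · intro a ha b hb hab
    obtain ⟨p, hp, hpl⟩ := hpath a ha
    obtain ⟨q, hq, hql⟩ := hpath b hb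
    have hbp : b ∉ p.support := fun hmem ↦ by
      have h₁ := Walk.length_takeUntil_lt_length hmem hab.ne'
      have h₂ := dist_le (p.takeUntil b hmem)
      rw [hS b hb] at h₂
      omega
    have hne : p.concat hab ≠ q := fun h ↦ by
      have := congrArg Walk.length h
      rw [Walk.length_concat] at this
      omega
    have := (hp.concat hbp hab).girth_le_length_add_length hq hne
    rw [Walk.length_concat] at this
    omega
  · rintro v hv a ⟨ha, hva⟩ b ⟨hb, hvb⟩
    obtain ⟨p, hp, hpl⟩ := hpath a ha
    obtain ⟨q, hq, hql⟩ := hpath b hb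
    subst hU
    have hvp : v ∉ p.support := fun h ↦ hv ⟨a, ha, p, hp, hpl, h⟩
    have hvq : v ∉ q.support := fun h ↦ hv ⟨b, hb, q, hq, hql, h⟩
    by_contra hab
    have hne : p.concat hva.symm ≠ q.concat hvb.symm := fun h ↦ hab (Walk.concat_inj h).1
    have := (hp.concat hvp hva.symm).girth_le_length_add_length (hq.concat hvq hvb.symm) hne
    rw [Walk.length_concat, Walk.length_concat] at this
    omega
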